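/- For every real s ≥ 6 there is a constant C such that for all t ≥ 0: ∫₀^t (t−σ) ⟨σ⟩³ ⟨σ⟩^{−(s−1)} ⟨t+σ⟩^{−s} dσ ≤ C ⟨t⟩^{−(s−1)}. -/

import Mathlib

open Real

noncomputable section

/-- The Japanese bracket `⟨x⟩ = (1+x²)^{1/2}`. -/
def jap (x : ℝ) : ℝ := Real.sqrt (1 + x ^ 2)

lemma jap_pos (x : ℝ) : 0 < jap x := Real.sqrt_pos.mpr (by positivity)

lemma one_le_jap (x : ℝ) : 1 ≤ jap x := Real.one_le_sqrt.mpr (by nlinarith [sq_nonneg x])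

lemma le_jap (x : ℝ) : x ≤ jap x := Real.le_sqrt_of_sq_le (by linarith)

lemma jap_le_jap {x y : ℝ} (hx : 0 ≤ x) (hxy : x ≤ y) : jap x ≤ jap y :=
  Real.sqrt_le_sqrt (by gcongr)

lemma continuous_jap : Continuous jap := by
  unfold jap
  fun_prop

lemma jap_rpow_neg_two (x : ℝ) : jap x ^ (-2 : ℝ) = (1 + x ^ 2)⁻¹ := by
  rw [Real.rpow_neg (jap_pos x).le, Real.rpow_two, jap, Real.sq_sqrt (by positivity)]

lemma continuous_jap_rpow (r : ℝ) : Continuous fun x => jap x ^ r :=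
  continuous_jap.rpow_const fun x => Or.inl (jap_pos x).ne'

lemma echo_integrand_le {s t σ : ℝ} (hs : 6 ≤ s) (hσ : 0 ≤ σ) (hσt : σ ≤ t) :
    (t - σ) * jap σ ^ (3 : ℝ) * jap σ ^ (-(s - 1)) * jap (t + σ) ^ (-s) ≤
      jap t ^ (-(s - 1)) * (1 + σ ^ 2)⁻¹ := by
  have h_decay : jap σ ^ (3 : ℝ) * jap σ ^ (-(s - 1)) ≤ (1 + σ ^ 2)⁻¹ := by
    rw [← Real.rpow_add (jap_pos σ), ← jap_rpow_neg_two]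
    exact Real.rpow_le_rpow_of_exponent_le (one_le_jap σ) (by linarith)
  have h_shift : jap (t + σ) ^ (-s) ≤ jap t ^ (-s) :=
    Real.rpow_le_rpow_of_nonpos (jap_pos t) (jap_le_jap (hσ.trans hσt) (by linarith))
      (by linarith)
  have h_weight : t - σ ≤ jap t := by linarith [le_jap t]
  have h_pow : jap t * jap t ^ (-s) = jap t ^ (-(s - 1)) := by
    rw [← Real.rpow_one_add' (jap_pos t).le (by linarith)]
    ring_nf
  have := jap_pos t
  have := jap_pos σ
  have := jap_pos (t + σ)
  calc (t - σ) * jap σ ^ (3 : ℝ) * jap σ ^ (-(s - 1)) * jap (t + σ) ^ (-s)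
      = (t - σ) * (jap σ ^ (3 : ℝ) * jap σ ^ (-(s - 1))) * jap (t + σ) ^ (-s) := by ring
    _ ≤ jap t * (1 + σ ^ 2)⁻¹ * jap t ^ (-s) := by gcongr
    _ = jap t ^ (-(s - 1)) * (1 + σ ^ 2)⁻¹ := by rw [← h_pow]; ring

/-- **Integral estimate (echo source term `F¹ₙ`).** For every real `s ≥ 6` there is a
constant `C` such that for all `t ≥ 0`:
`∫₀ᵗ (t-σ) ⟨σ⟩³ ⟨σ⟩^{-(s-1)} ⟨t+σ⟩^{-s} dσ ≤ C ⟨t⟩^{-(s-1)}`. -/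
theorem echo_integral_estimate (s : ℝ) (hs : 6 ≤ s) :
    ∃ C : ℝ, 0 < C ∧ ∀ t : ℝ, 0 ≤ t →
      (∫ σ in (0 : ℝ)..t,
          (t - σ) * jap σ ^ (3 : ℝ) * jap σ ^ (-(s - 1)) * jap (t + σ) ^ (-s)) ≤
        C * jap t ^ (-(s - 1)) := by
  refine ⟨π / 2, by positivity, fun t ht => ?_⟩
  have h_int : IntervalIntegrable
      (fun σ => (t - σ) * jap σ ^ (3 : ℝ) * jap σ ^ (-(s - 1)) * jap (t + σ) ^ (-s))
      MeasureTheory.volume 0 t :=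
    Continuous.intervalIntegrable
      ((((continuous_const.sub continuous_id).mul (continuous_jap_rpow _)).mul
        (continuous_jap_rpow _)).mul
        ((continuous_jap_rpow _).comp (continuous_const.add continuous_id))) _ _
  calc _ ≤ ∫ σ in (0 : ℝ)..t, jap t ^ (-(s - 1)) * (1 + σ ^ 2)⁻¹ :=
        intervalIntegral.integral_mono_on ht h_int
          (intervalIntegral.intervalIntegrable_inv_one_add_sq.const_mul _)
          fun σ hσ => echo_integrand_le hs hσ.1 hσ.2
    _ = arctan t * jap t ^ (-(s - 1)) := by
        rw [intervalIntegral.integral_const_mul, integral_inv_one_add_sq, arctan_zero, sub_zero,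
          mul_comm]
    _ ≤ π / 2 * jap t ^ (-(s - 1)) :=
        mul_le_mul_of_nonneg_right (arctan_lt_pi_div_two t).le
          (Real.rpow_nonneg (jap_pos t).le _)
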